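/- A nonnegative integer n is represented by the quaternary quadratic form x₁² + 2x₂² + 16y₁² + 32y₂² if and only if n ≡ 0 (mod 4), or n ≡ 1 or 3 (mod 8), or n ≡ 2 or 6 (mod 16). (This is the regularity of the binary Hermitian lattice ⟨1,16⟩ over ℚ(√-2), stated for its associated quadratic form.) -/

import Mathlib

theorem Int.exists_sum_four_squares {n : ℤ} (hn : 0 ≤ n) :
    ∃ a b c d : ℤ, a ^ 2 + b ^ 2 + c ^ 2 + d ^ 2 = n := by
  obtain ⟨a, b, c, d, h⟩ := Nat.sum_four_squares n.toNat
  refine ⟨a, b, c, d, ?_⟩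
  have h' : ((a ^ 2 + b ^ 2 + c ^ 2 + d ^ 2 : ℕ) : ℤ) = (n.toNat : ℤ) := by rw [h]
  push_cast at h'
  rw [h', Int.toNat_of_nonneg hn]

theorem Int.exists_sq_eq_four_mul_or (x : ℤ) :
    (∃ k, x = 2 * k ∧ x ^ 2 = 4 * k ^ 2) ∨
      ∃ k t, x = 2 * k + 1 ∧ x ^ 2 = 8 * t + 1 := by
  obtain ⟨k, rfl | rfl⟩ := Int.even_or_odd' x
  · exact Or.inl ⟨k, rfl, by ring⟩
  · obtain ⟨t, ht⟩ := Int.even_mul_succ_self k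
    exact Or.inr ⟨k, t, rfl, by linear_combination 4 * ht⟩

/-- Two of three integers have the same parity. -/
theorem Int.exists_sum_three_squares_eq (a b c : ℤ) :
    ∃ e z w : ℤ, a ^ 2 + b ^ 2 + c ^ 2 = e ^ 2 + 2 * z ^ 2 + 2 * w ^ 2 := by
  obtain ⟨a, rfl | rfl⟩ := Int.even_or_odd' a <;> obtain ⟨b, rfl | rfl⟩ := Int.even_or_odd' b <;>
    obtain ⟨c, rfl | rfl⟩ := Int.even_or_odd' c
  · exact ⟨2 * c, a + b, a - b, by ring⟩
  · exact ⟨2 * c + 1, a + b, a - b, by ring⟩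
  · exact ⟨2 * b + 1, a + c, a - c, by ring⟩
  · exact ⟨2 * a, b + c + 1, b - c, by ring⟩
  · exact ⟨2 * a + 1, b + c, b - c, by ring⟩
  · exact ⟨2 * b, a + c + 1, a - c, by ring⟩
  · exact ⟨2 * c, a + b + 1, a - b, by ring⟩
  · exact ⟨2 * c + 1, a + b + 1, a - b, by ring⟩

theorem Int.exists_one_odd_three_even {n : ℤ} (hn : 0 ≤ n) (h : n % 4 = 1) :
    ∃ a b c d : ℤ, (2 * a + 1) ^ 2 + 4 * (b ^ 2 + c ^ 2 + d ^ 2) = n := by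
  obtain ⟨a, b, c, d, hs⟩ := exists_sum_four_squares hn
  rcases exists_sq_eq_four_mul_or a with ⟨a', ha, ha2⟩ | ⟨a', s, ha, ha2⟩ <;>
  rcases exists_sq_eq_four_mul_or b with ⟨b', hb, hb2⟩ | ⟨b', t, hb, hb2⟩ <;>
  rcases exists_sq_eq_four_mul_or c with ⟨c', hc, hc2⟩ | ⟨c', u, hc, hc2⟩ <;>
  rcases exists_sq_eq_four_mul_or d with ⟨d', hd, hd2⟩ | ⟨d', v, hd, hd2⟩ <;>
  first
  | (exfalso; omega)
  | exact ⟨a', b', c', d', by rw [← ha]; linarith⟩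
  | exact ⟨b', a', c', d', by rw [← hb]; linarith⟩
  | exact ⟨c', a', b', d', by rw [← hc]; linarith⟩
  | exact ⟨d', a', b', c', by rw [← hd]; linarith⟩

theorem Int.exists_three_odd_one_even {n : ℤ} (hn : 0 ≤ n) (h : n % 4 = 3) :
    ∃ a b c d : ℤ,
      (2 * a + 1) ^ 2 + (2 * b + 1) ^ 2 + (2 * c + 1) ^ 2 + 4 * d ^ 2 = n := by
  obtain ⟨a, b, c, d, hs⟩ := exists_sum_four_squares hn
  rcases exists_sq_eq_four_mul_or a with ⟨a', ha, ha2⟩ | ⟨a', s, ha, ha2⟩ <;>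
  rcases exists_sq_eq_four_mul_or b with ⟨b', hb, hb2⟩ | ⟨b', t, hb, hb2⟩ <;>
  rcases exists_sq_eq_four_mul_or c with ⟨c', hc, hc2⟩ | ⟨c', u, hc, hc2⟩ <;>
  rcases exists_sq_eq_four_mul_or d with ⟨d', hd, hd2⟩ | ⟨d', v, hd, hd2⟩ <;>
  first
  | (exfalso; omega)
  | exact ⟨a', b', c', d', by rw [← ha, ← hb, ← hc]; linarith⟩
  | exact ⟨a', b', d', c', by rw [← ha, ← hb, ← hd]; linarith⟩
  | exact ⟨a', c', d', b', by rw [← ha, ← hc, ← hd]; linarith⟩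
  | exact ⟨b', c', d', a', by rw [← hb, ← hc, ← hd]; linarith⟩

theorem Int.exists_form_one_eight_sixteen_thirtytwo {n : ℤ} (hn : 0 ≤ n) (h : n % 8 = 1) :
    ∃ x y z w : ℤ, x ^ 2 + 8 * y ^ 2 + 16 * z ^ 2 + 32 * w ^ 2 = n := by
  have key : ∀ a b c d : ℤ, a ^ 2 + 4 * ((2 * b + 1) ^ 2 + (2 * c + 1) ^ 2 + (2 * d) ^ 2) = n →
      ∃ x y z w : ℤ, x ^ 2 + 8 * y ^ 2 + 16 * z ^ 2 + 32 * w ^ 2 = n := by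
    intro a b c d hs
    obtain ⟨k, hk | hk⟩ := Int.even_or_odd' (b - c)
    · obtain rfl : b = c + 2 * k := by omega
      exact ⟨a, 2 * c + 2 * k + 1, d, k, by rw [← hs]; ring⟩
    · obtain rfl : b = c + 2 * k + 1 := by omega
      exact ⟨a, 2 * k + 1, d, c + k + 1, by rw [← hs]; ring⟩
  obtain ⟨a, b, c, d, hs⟩ := exists_one_odd_three_even hn (by omega)
  obtain ha | ⟨_, s, -, ha⟩ := exists_sq_eq_four_mul_or (2 * a + 1)
  · obtain ⟨k, hk, -⟩ := ha
    omega
  rcases exists_sq_eq_four_mul_or b with ⟨b', hb, hb2⟩ | ⟨b', t, hb, hb2⟩ <;>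
  rcases exists_sq_eq_four_mul_or c with ⟨c', hc, hc2⟩ | ⟨c', u, hc, hc2⟩ <;>
  rcases exists_sq_eq_four_mul_or d with ⟨d', hd, hd2⟩ | ⟨d', v, hd, hd2⟩ <;>
  try (exfalso; omega)
  · obtain ⟨e, z, w, he⟩ := exists_sum_three_squares_eq b' c' d'
    exact ⟨2 * a + 1, 2 * z, e, w, by linarith⟩
  · exact key (2 * a + 1) c' d' b' (by rw [← hb, ← hc, ← hd]; linarith)
  · exact key (2 * a + 1) b' d' c' (by rw [← hb, ← hc, ← hd]; linarith)
  · exact key (2 * a + 1) b' c' d' (by rw [← hb, ← hc, ← hd]; linarith)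

theorem Int.exists_odd_sq_eq (a : ℤ) :
    ∃ k : ℤ, (2 * a + 1) ^ 2 = (8 * k + 1) ^ 2 ∨ (2 * a + 1) ^ 2 = (8 * k + 3) ^ 2 := by
  have h : a % 4 = 0 ∨ a % 4 = 1 ∨ a % 4 = 2 ∨ a % 4 = 3 := by omega
  obtain ⟨k, hk⟩ : ∃ k, k = a / 4 := ⟨_, rfl⟩
  rcases h with h | h | h | h
  · obtain rfl : a = 4 * k := by omega
    exact ⟨k, Or.inl (by ring)⟩
  · obtain rfl : a = 4 * k + 1 := by omega
    exact ⟨k, Or.inr (by ring)⟩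
  · obtain rfl : a = 4 * k + 2 := by omega
    exact ⟨-k - 1, Or.inr (by ring)⟩
  · obtain rfl : a = 4 * k + 3 := by omega
    exact ⟨-k - 1, Or.inl (by ring)⟩

theorem Int.exists_form_one_two_sixteen_thirtytwo {n : ℤ} (hn : 0 ≤ n) (h : n % 8 = 3) :
    ∃ x y z w : ℤ, x ^ 2 + 2 * y ^ 2 + 16 * z ^ 2 + 32 * w ^ 2 = n := by
  have key : ∀ r a b c d : ℤ, (8 * a + r) ^ 2 + (8 * b + r) ^ 2 + c ^ 2 + 16 * d ^ 2 = n →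
      ∃ x y z w : ℤ, x ^ 2 + 2 * y ^ 2 + 16 * z ^ 2 + 32 * w ^ 2 = n := fun r a b c d hs ↦
    ⟨c, 4 * a + 4 * b + r, d, a - b, by rw [← hs]; ring⟩
  obtain ⟨a, b, c, d, hs⟩ := exists_three_odd_one_even hn (by omega)
  obtain ⟨e, rfl⟩ : ∃ e, d = 2 * e := by
    obtain ⟨s, hs1⟩ := Int.even_mul_succ_self a
    obtain ⟨t, ht1⟩ := Int.even_mul_succ_self b
    obtain ⟨u, hu1⟩ := Int.even_mul_succ_self c
    have hn' : 8 * (s + t + u) + 3 + 4 * d ^ 2 = n := by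
      linear_combination hs - 4 * hs1 - 4 * ht1 - 4 * hu1
    rcases exists_sq_eq_four_mul_or d with ⟨k, hk, -⟩ | ⟨k, v, -, hv⟩
    · exact ⟨k, hk⟩
    · omega
  obtain ⟨a', ha | ha⟩ := exists_odd_sq_eq a <;> obtain ⟨b', hb | hb⟩ := exists_odd_sq_eq b <;>
    obtain ⟨c', hc | hc⟩ := exists_odd_sq_eq c
  · exact key 1 a' b' (2 * c + 1) e (by linarith)
  · exact key 1 a' b' (2 * c + 1) e (by linarith)
  · exact key 1 a' c' (2 * b + 1) e (by linarith)
  · exact key 3 b' c' (2 * a + 1) e (by linarith)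
  · exact key 1 b' c' (2 * a + 1) e (by linarith)
  · exact key 3 a' c' (2 * b + 1) e (by linarith)
  · exact key 3 a' b' (2 * c + 1) e (by linarith)
  · exact key 3 a' b' (2 * c + 1) e (by linarith)

theorem Int.exists_form_one_two_two_four {n : ℤ} (hn : 0 ≤ n) :
    ∃ x y z w : ℤ, x ^ 2 + 2 * y ^ 2 + 2 * z ^ 2 + 4 * w ^ 2 = n := by
  have key : ∀ a b c d : ℤ, a ^ 2 + b ^ 2 + c ^ 2 + 4 * d ^ 2 = n →
      ∃ x y z w : ℤ, x ^ 2 + 2 * y ^ 2 + 2 * z ^ 2 + 4 * w ^ 2 = n := by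
    intro a b c d hs
    obtain ⟨e, z, w, he⟩ := exists_sum_three_squares_eq a b c
    exact ⟨e, z, w, d, by linarith⟩
  obtain ⟨a, b, c, d, hs⟩ := exists_sum_four_squares hn
  rcases exists_sq_eq_four_mul_or a with ⟨a', -, ha⟩ | ⟨-, s, -, ha⟩
  · exact key b c d a' (by linarith)
  rcases exists_sq_eq_four_mul_or b with ⟨b', -, hb⟩ | ⟨-, t, -, hb⟩
  · exact key a c d b' (by linarith)
  rcases exists_sq_eq_four_mul_or c with ⟨c', -, hc⟩ | ⟨-, u, -, hc⟩
  · exact key a b d c' (by linarith)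
  rcases exists_sq_eq_four_mul_or d with ⟨d', -, hd⟩ | ⟨-, v, -, hd⟩
  · exact key a b c d' (by linarith)
  obtain ⟨p, q, r, l, hl⟩ := exists_sum_four_squares (n := n / 4) (by omega)
  exact key (2 * p) (2 * q) (2 * r) l (by
    have : 4 * (n / 4) = n := by omega
    linarith)

theorem Int.exists_form_one_two_four_eight {n : ℤ} (hn : 0 ≤ n) :
    ∃ x y z w : ℤ, x ^ 2 + 2 * y ^ 2 + 4 * z ^ 2 + 8 * w ^ 2 = n := by
  have h : n % 2 = 0 ∨ n % 4 = 1 ∨ n % 4 = 3 := by omega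
  rcases h with h | h | h
  · obtain ⟨x, y, z, w, hs⟩ := exists_form_one_two_two_four (n := n / 2) (by omega)
    have : 2 * (n / 2) = n := by omega
    exact ⟨2 * y, x, z, w, by linarith⟩
  · obtain ⟨a, b, c, d, hs⟩ := exists_one_odd_three_even hn h
    obtain ⟨e, z, w, he⟩ := exists_sum_three_squares_eq b c d
    exact ⟨2 * a + 1, 2 * z, e, w, by linarith⟩
  · obtain ⟨a, b, c, d, hs⟩ := exists_three_odd_one_even hn h
    obtain ⟨k, hk | hk⟩ := Int.even_or_odd' (a - b)
    · obtain rfl : a = b + 2 * k := by omega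
      exact ⟨2 * c + 1, 2 * b + 2 * k + 1, d, k, by rw [← hs]; ring⟩
    · obtain rfl : a = b + 2 * k + 1 := by omega
      exact ⟨2 * c + 1, 2 * k + 1, d, b + k + 1, by rw [← hs]; ring⟩

theorem stmt_3 (n : ℤ) (hn : 0 ≤ n) :
    (∃ x1 x2 y1 y2 : ℤ, x1^2 + 2*x2^2 + 16*y1^2 + 32*y2^2 = n) ↔
    (n % 4 = 0 ∨ n % 8 = 1 ∨ n % 8 = 3 ∨ n % 16 = 2 ∨ n % 16 = 6) := by
  constructor
  · rintro ⟨x, y, z, w, hs⟩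
    rcases Int.exists_sq_eq_four_mul_or x with ⟨x', -, hx⟩ | ⟨-, s, -, hx⟩ <;>
    rcases Int.exists_sq_eq_four_mul_or y with ⟨y', -, hy⟩ | ⟨-, t, -, hy⟩
    · omega
    · rcases Int.exists_sq_eq_four_mul_or x' with ⟨x'', -, hx'⟩ | ⟨-, u, -, hx'⟩ <;> omega
    · omega
    · omega
  · rintro (h | h | h | h | h)
    · obtain ⟨x, y, z, w, hs⟩ := Int.exists_form_one_two_four_eight (n := n / 4) (by omega)
      have : 4 * (n / 4) = n := by omega
      exact ⟨2 * x, 2 * y, z, w, by linarith⟩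
    · obtain ⟨x, y, z, w, hs⟩ := Int.exists_form_one_eight_sixteen_thirtytwo hn h
      exact ⟨x, 2 * y, z, w, by linarith⟩
    · exact Int.exists_form_one_two_sixteen_thirtytwo hn h
    · obtain ⟨x, y, z, w, hs⟩ :=
        Int.exists_form_one_eight_sixteen_thirtytwo (n := n / 2) (by omega) (by omega)
      have : 2 * (n / 2) = n := by omega
      exact ⟨8 * w, x, y, z, by linarith⟩
    · obtain ⟨x, y, z, w, hs⟩ :=
        Int.exists_form_one_two_sixteen_thirtytwo (n := n / 2) (by omega) (by omega)
      have : 2 * (n / 2) = n := by omega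
      exact ⟨2 * y, x, 2 * w, z, by linarith⟩
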